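/- arXiv:math/9910163 — 4 statements merged into one kernel-verified Lean document; each statement's English description precedes it below -/
import Mathlib

section
/- For every real number c > 1 there exists a bounded operator T on a (complex, infinite-dimensional) Hilbert space H which is power-bounded (sup_n ‖T^n‖ < ∞) but such that every operator similar to T has large powers: for every invertible bounded operator A on H one has sup_n ‖(A⁻¹TA)^n‖ > c. -/
open Filter Topology

namespace PellerCounterexample

section Diagonal

variable {H : Type*} [NormedAddCommGroup H] [InnerProductSpace ℂ H] [CompleteSpace H]

/-- A monotone sequence `l` with limit `1` has increments summing to `1 - l 0`. -/
lemma hasSum_increments {l : ℕ → ℝ} (hl : Monotone l) (hlim : Tendsto l atTop (𝓝 1)) :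
    HasSum (fun n => l (n + 1) - l n) (1 - l 0) := by
  rw [hasSum_iff_tendsto_nat_of_nonneg fun n => sub_nonneg.2 (hl n.le_succ)]
  simp only [Finset.sum_range_sub]
  exact hlim.sub_const _

/-- The increments of `l` from index `j` on sum to `1 - l j`. -/
lemma hasSum_increments_from {l : ℕ → ℝ} (hl : Monotone l) (hlim : Tendsto l atTop (𝓝 1))
    (j : ℕ) : HasSum (fun n => if j < n + 1 then l (n + 1) - l n else 0) (1 - l j) := by
  have h := hasSum_increments (l := fun n => l (max n j))
    (fun a b hab => hl (max_le_max_right j hab))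
    (hlim.comp (tendsto_atTop_mono (fun n => le_max_left n j) tendsto_id))
  simp only [Nat.zero_max] at h
  refine h.congr_fun fun n => ?_
  by_cases hj : j < n + 1
  · simp [hj, max_eq_left (Nat.lt_succ_iff.1 hj), max_eq_left hj.le]
  · have : n + 1 ≤ j := not_lt.1 hj
    simp [hj, max_eq_right this, max_eq_right (n.le_succ.trans this)]

/-- The operator with eigenvalue `l j` on the `j`-th block of the chain of projections `P`,
written by summation by parts. -/
noncomputable def diagonalOp (P : ℕ → H →L[ℂ] H) (l : ℕ → ℝ) : H →L[ℂ] H :=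
  1 - ∑' n, ((l (n + 1) - l n : ℝ) : ℂ) • P (n + 1)

variable {P : ℕ → H →L[ℂ] H} {l : ℕ → ℝ} {M : ℝ}

lemma norm_increment_smul_le (hP : ∀ n, ‖P n‖ ≤ M) (hl : Monotone l) (n : ℕ) :
    ‖((l (n + 1) - l n : ℝ) : ℂ) • P (n + 1)‖ ≤ (l (n + 1) - l n) * M := by
  have h := sub_nonneg.2 (hl n.le_succ)
  rw [norm_smul, Complex.norm_real, Real.norm_of_nonneg h]
  exact mul_le_mul_of_nonneg_left (hP _) h

lemma summable_increment_smul (hP : ∀ n, ‖P n‖ ≤ M) (hl : Monotone l)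
    (hlim : Tendsto l atTop (𝓝 1)) :
    Summable fun n => ((l (n + 1) - l n : ℝ) : ℂ) • P (n + 1) :=
  Summable.of_norm_bounded ((hasSum_increments hl hlim).mul_right M).summable
    (norm_increment_smul_le hP hl)

lemma norm_diagonalOp_le (hP : ∀ n, ‖P n‖ ≤ M) (hl : Monotone l) (h0 : 0 ≤ l 0)
    (hlim : Tendsto l atTop (𝓝 1)) : ‖diagonalOp P l‖ ≤ 1 + M := by
  have hM : 0 ≤ M := (norm_nonneg _).trans (hP 0)
  refine (norm_sub_le _ _).trans (add_le_add ContinuousLinearMap.norm_id_le ?_)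
  refine (tsum_of_norm_bounded ((hasSum_increments hl hlim).mul_right M)
    (norm_increment_smul_le hP hl)).trans ?_
  nlinarith

/-- If nearly all of the increment of `l` occurs at `n`, then `diagonalOp P l` is close to the
complementary projection `1 - P (n + 1)`. -/
lemma norm_one_sub_sub_diagonalOp_le (hP : ∀ n, ‖P n‖ ≤ M) (hl : Monotone l) (h0 : 0 ≤ l 0)
    (hlim : Tendsto l atTop (𝓝 1)) (n : ℕ) :
    ‖(1 - P (n + 1)) - diagonalOp P l‖ ≤ 2 * M * (1 - (l (n + 1) - l n)) := by
  have hM : 0 ≤ M := (norm_nonneg _).trans (hP 0)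
  have hd : l (n + 1) - l n ≤ 1 := by
    have := hl (Nat.zero_le n)
    have := hl.ge_of_tendsto hlim (n + 1)
    linarith
  have hS := (summable_increment_smul hP hl hlim).hasSum.sub (hasSum_ite_eq n (P (n + 1)))
  have hB := ((hasSum_increments hl hlim).add
    (hasSum_ite_eq n (1 - 2 * (l (n + 1) - l n)))).mul_right M
  have heq : (1 - P (n + 1)) - diagonalOp P l =
      ∑' m, (((l (m + 1) - l m : ℝ) : ℂ) • P (m + 1) - if m = n then P (n + 1) else 0) := by
    rw [hS.tsum_eq, diagonalOp]; abel
  rw [heq]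
  refine (tsum_of_norm_bounded hB fun m => ?_).trans ?_
  · by_cases hm : m = n
    · subst hm
      have h1 : ((l (m + 1) - l m : ℝ) : ℂ) • P (m + 1) - P (m + 1)
          = ((l (m + 1) - l m - 1 : ℝ) : ℂ) • P (m + 1) := by
        rw [Complex.ofReal_sub _ (1 : ℝ), sub_smul, Complex.ofReal_one, one_smul]
      simp only [if_true, h1, norm_smul, Complex.norm_real, Real.norm_eq_abs]
      rw [abs_of_nonpos (by linarith)]
      have := mul_le_mul_of_nonneg_left (hP (m + 1)) (sub_nonneg.2 hd)
      linarith
    · simpa [hm] using norm_increment_smul_le hP hl m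
  · nlinarith

variable {φ : ℕ → H →L[ℂ] ℂ}

lemma coord_diagonalOp (hP : ∀ n, ‖P n‖ ≤ M)
    (hφP : ∀ j n x, φ j (P n x) = if j < n then φ j x else 0)
    (hl : Monotone l) (hlim : Tendsto l atTop (𝓝 1)) (j : ℕ) (x : H) :
    φ j (diagonalOp P l x) = l j * φ j x := by
  have h1 := (((summable_increment_smul hP hl hlim).hasSum.mapL
    (ContinuousLinearMap.apply ℂ H x)).mapL (φ j))
  have h2 : HasSum (fun n => ((if j < n + 1 then l (n + 1) - l n else 0 : ℝ) : ℂ) * φ j x)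
      (((1 - l j : ℝ) : ℂ) * φ j x) :=
    (Complex.hasSum_ofReal.2 (hasSum_increments_from hl hlim j)).mul_right _
  have h3 : (fun n => φ j (ContinuousLinearMap.apply ℂ H x
      (((l (n + 1) - l n : ℝ) : ℂ) • P (n + 1)))) =
      fun n => ((if j < n + 1 then l (n + 1) - l n else 0 : ℝ) : ℂ) * φ j x := by
    funext n
    simp only [ContinuousLinearMap.apply_apply, map_smul, hφP, smul_eq_mul]
    split_ifs <;> simp
  rw [h3] at h1
  have h4 := h1.unique h2
  rw [ContinuousLinearMap.apply_apply] at h4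
  rw [diagonalOp, sub_apply, map_sub, h4, one_apply_eq_self]
  push_cast
  ring

lemma diagonalOp_pow (hP : ∀ n, ‖P n‖ ≤ M)
    (hφP : ∀ j n x, φ j (P n x) = if j < n then φ j x else 0)
    (hφ : ∀ x y, (∀ j, φ j x = φ j y) → x = y)
    (hl : Monotone l) (h0 : 0 ≤ l 0) (hlim : Tendsto l atTop (𝓝 1)) (k : ℕ) :
    diagonalOp P l ^ k = diagonalOp P fun n => l n ^ k := by
  have hk : Monotone fun n => l n ^ k := fun a b hab =>
    pow_le_pow_left₀ (h0.trans (hl a.zero_le)) (hl hab) k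
  have hklim : Tendsto (fun n => l n ^ k) atTop (𝓝 1) := by simpa using hlim.pow k
  ext x
  refine hφ _ _ fun j => ?_
  rw [coord_diagonalOp hP hφP hk hklim]
  clear hk hklim
  induction k generalizing x with
  | zero => simp
  | succ k ih =>
    rw [pow_succ, mul_apply_eq_comp, ih, coord_diagonalOp hP hφP hl hlim]
    push_cast
    ring

end Diagonal

section Eigenvalues

/-- Eigenvalues tending to `1` so fast that suitable powers separate consecutive ones. -/
noncomputable def eigenvalue (n : ℕ) : ℝ := 1 - 1 / (n.factorial : ℝ) ^ 2

lemma eigenvalue_monotone : Monotone eigenvalue := by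
  intro a b hab
  have ha : (0 : ℝ) < a.factorial := by exact_mod_cast a.factorial_pos
  have h : (a.factorial : ℝ) ≤ b.factorial := by exact_mod_cast Nat.factorial_le hab
  unfold eigenvalue
  gcongr

lemma eigenvalue_zero : eigenvalue 0 = 0 := by simp [eigenvalue]

lemma eigenvalue_nonneg (n : ℕ) : 0 ≤ eigenvalue n :=
  eigenvalue_zero.ge.trans (eigenvalue_monotone n.zero_le)

lemma eigenvalue_pow_monotone (k : ℕ) : Monotone fun n => eigenvalue n ^ k := fun i _ hij =>
  pow_le_pow_left₀ (eigenvalue_nonneg i) (eigenvalue_monotone hij) k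

lemma tendsto_eigenvalue : Tendsto eigenvalue atTop (𝓝 1) := by
  have h : Tendsto (fun n : ℕ => (n.factorial : ℝ) ^ 2) atTop atTop :=
    (tendsto_pow_atTop two_ne_zero).comp
      (tendsto_natCast_atTop_atTop.comp
        (tendsto_atTop_mono Nat.self_le_factorial tendsto_id))
  have h' := h.inv_tendsto_atTop.const_sub (1 : ℝ)
  rw [sub_zero] at h'
  exact h'.congr fun n => by simp [eigenvalue]

lemma tendsto_eigenvalue_pow (k : ℕ) : Tendsto (fun n => eigenvalue n ^ k) atTop (𝓝 1) := by
  simpa using tendsto_eigenvalue.pow k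

lemma exists_pow_eigenvalue_gap (n : ℕ) :
    ∃ k : ℕ, 1 - (eigenvalue (n + 1) ^ k - eigenvalue n ^ k) ≤ 2 / (n + 1) := by
  refine ⟨(n + 1).factorial * n.factorial, ?_⟩
  have hf : (0 : ℝ) < n.factorial := by exact_mod_cast n.factorial_pos
  have hn : (0 : ℝ) < n + 1 := by positivity
  have hs : ((n + 1).factorial : ℝ) = (n + 1) * n.factorial := by
    push_cast [Nat.factorial_succ]; ring
  set k := (n + 1).factorial * n.factorial with hk
  have hkr : (k : ℝ) = (n + 1) * n.factorial * n.factorial := by rw [hk]; push_cast [hs]; ring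
  have h1 : 1 - 1 / ((n : ℝ) + 1) ≤ eigenvalue (n + 1) ^ k := by
    have h := one_add_mul_le_pow (a := -(1 / ((n + 1).factorial : ℝ) ^ 2))
      (by have := eigenvalue_nonneg (n + 1); unfold eigenvalue at this; linarith) k
    have e : 1 + (k : ℝ) * -(1 / ((n + 1).factorial : ℝ) ^ 2) = 1 - 1 / ((n : ℝ) + 1) := by
      rw [hkr, hs]; field_simp; ring
    rw [e] at h
    simpa [eigenvalue, sub_eq_add_neg] using h
  have h2 : eigenvalue n ^ k ≤ 1 / ((n : ℝ) + 1) := by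
    have hpos : (0 : ℝ) < 1 + 1 / (n.factorial : ℝ) ^ 2 := by positivity
    have hle : eigenvalue n * (1 + 1 / (n.factorial : ℝ) ^ 2) ≤ 1 := by
      unfold eigenvalue; nlinarith [sq_nonneg (1 / (n.factorial : ℝ) ^ 2)]
    have hB : (n : ℝ) + 1 ≤ (1 + 1 / (n.factorial : ℝ) ^ 2) ^ k := by
      have h := one_add_mul_le_pow (a := 1 / (n.factorial : ℝ) ^ 2)
        (by have : 0 < 1 / (n.factorial : ℝ) ^ 2 := by positivity
            linarith) k
      have e : (k : ℝ) * (1 / (n.factorial : ℝ) ^ 2) = n + 1 := by rw [hkr]; field_simp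
      rw [e] at h
      linarith
    rw [le_div_iff₀ hn]
    calc eigenvalue n ^ k * (n + 1)
        ≤ eigenvalue n ^ k * (1 + 1 / (n.factorial : ℝ) ^ 2) ^ k :=
          mul_le_mul_of_nonneg_left hB (pow_nonneg (eigenvalue_nonneg n) k)
      _ = (eigenvalue n * (1 + 1 / (n.factorial : ℝ) ^ 2)) ^ k := (mul_pow _ _ _).symm
      _ ≤ 1 := pow_le_one₀ (mul_nonneg (eigenvalue_nonneg n) hpos.le) hle
  have : (2 : ℝ) / (n + 1) = 1 / (n + 1) + 1 / (n + 1) := by ring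
  linarith

end Eigenvalues

section Growth

variable {H : Type*} [NormedAddCommGroup H] [InnerProductSpace ℂ H]

/-- In a Hilbert space, a chain of projections `R n` with `‖1 - R n‖ ≤ b` satisfies a nontrivial
upper estimate on sums over dyadic-length blocks. -/
lemma norm_sum_block_sq_le {R : ℕ → H →L[ℂ] H} {y : ℕ → H} {b K : ℝ} {n₀ : ℕ} (hb : 1 ≤ b)
    (hR : ∀ n, n₀ ≤ n → ‖1 - R n‖ ≤ b) (hRy : ∀ n j, R n (y j) = if j < n then y j else 0)
    (hy : ∀ j, ‖y j‖ ≤ K) (k a : ℕ) (ha : n₀ ≤ a) :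
    ‖∑ j ∈ Finset.Ico a (a + 2 ^ k), y j‖ ^ 2 ≤ (4 - 1 / b ^ 2) ^ k * K ^ 2 := by
  induction k generalizing a with
  | zero => simpa using pow_le_pow_left₀ (norm_nonneg _) (hy a) 2
  | succ k ih =>
    set u := ∑ j ∈ Finset.Ico a (a + 2 ^ k), y j
    set v := ∑ j ∈ Finset.Ico (a + 2 ^ k) (a + 2 ^ k + 2 ^ k), y j
    have huv : ∑ j ∈ Finset.Ico a (a + 2 ^ (k + 1)), y j = u + v := by
      rw [Finset.sum_Ico_consecutive _ (by lia) (by lia)]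
      congr 2; ring
    have hu := ih a ha
    have hv := ih (a + 2 ^ k) (by lia)
    have hRu : R (a + 2 ^ k) u = u := by
      rw [map_sum]
      refine Finset.sum_congr rfl fun j hj => ?_
      rw [hRy, if_pos (Finset.mem_Ico.1 hj).2]
    have hRv : R (a + 2 ^ k) v = 0 := by
      rw [map_sum]
      refine Finset.sum_eq_zero fun j hj => ?_
      rw [hRy, if_neg (not_lt.2 (Finset.mem_Ico.1 hj).1)]
    have hvle : ‖v‖ ≤ b * ‖u - v‖ := by
      have h := (1 - R (a + 2 ^ k)).le_of_opNorm_le (hR (a + 2 ^ k) (by lia)) (u - v)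
      simpa [hRu, hRv] using h
    have hsq : 1 / b ^ 2 * ‖v‖ ^ 2 ≤ ‖u - v‖ ^ 2 := by
      rw [one_div, inv_mul_le_iff₀ (by positivity), ← mul_pow]
      exact pow_le_pow_left₀ (norm_nonneg _) hvle 2
    have hpar := parallelogram_law_with_norm ℂ u v
    have hb1 : 1 / b ^ 2 ≤ 1 := by
      rw [div_le_one (by positivity)]
      exact one_le_pow₀ hb
    have hv' := mul_le_mul_of_nonneg_left hv (show 0 ≤ 2 - 1 / b ^ 2 by linarith)
    rw [huv, pow_succ (4 - 1 / b ^ 2)]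
    linarith

end Growth

section SquareSummable

lemma memℓp_two_of_sum_le {ι : Type*} {f : ι → ℂ} {C : ℝ}
    (hf : ∀ s : Finset ι, ∑ i ∈ s, ‖f i‖ ^ 2 ≤ C) : Memℓp f 2 :=
  memℓp_gen' (C := C) fun s => by simpa using hf s

lemma sum_sq_le_norm_sq {ι : Type*} (f : lp (fun _ : ι => ℂ) 2) (s : Finset ι) :
    ∑ i ∈ s, ‖f i‖ ^ 2 ≤ ‖f‖ ^ 2 := by
  simpa using lp.sum_rpow_le_norm_rpow (p := 2) (by simp) f s

lemma norm_le_of_sum_sq_le {ι : Type*} {f : lp (fun _ : ι => ℂ) 2} {C : ℝ} (hC : 0 ≤ C)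
    (hf : ∀ s : Finset ι, ∑ i ∈ s, ‖f i‖ ^ 2 ≤ C ^ 2) : ‖f‖ ≤ C :=
  lp.norm_le_of_forall_sum_le (p := 2) (by simp) hC fun s => by simpa using hf s

/-- A finite sum of nonnegative terms living on the graph of `q` is bounded by the partial sums
along the first coordinate. -/
lemma sum_graph_le {G : ℕ → ℝ} {q : ℕ → ℕ} {C : ℝ} (hG : ∀ m, 0 ≤ G m)
    (hC : ∀ L, ∑ m ∈ Finset.range L, G m ≤ C) (s : Finset (ℕ × ℕ)) :
    ∑ p ∈ s, (if p.2 = q p.1 then G p.1 else 0) ≤ C := by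
  rw [← Finset.sum_filter]
  have hinj : Set.InjOn Prod.fst (s.filter fun p => p.2 = q p.1 : Set (ℕ × ℕ)) := by
    rintro ⟨a, b⟩ h ⟨a', b'⟩ h' (rfl : a = a')
    simp only [Finset.coe_filter, Set.mem_ofPred_eq] at h h'
    rw [h.2, h'.2]
  rw [← Finset.sum_image (g := Prod.fst) (f := G) hinj]
  obtain ⟨L, hL⟩ := Finset.exists_nat_subset_range ((s.filter fun p => p.2 = q p.1).image Prod.fst)
  exact (Finset.sum_le_sum_of_subset_of_nonneg hL fun m _ _ => hG m).trans (hC L)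

/-- A sequence contracted at each step, up to a perturbation of controlled sum, has bounded
partial sums. -/
lemma sum_range_le_of_contraction {G b : ℕ → ℝ} {t C B : ℝ} (ht0 : 0 ≤ t) (ht : t < 1)
    (hC : 0 ≤ C) (hB : ∀ L, ∑ m ∈ Finset.range L, b m ≤ B) (h0 : G 0 = 0)
    (hG : ∀ m, G (m + 1) ≤ t * G m + C * b m) (L : ℕ) :
    ∑ m ∈ Finset.range L, G m ≤ C * B / (1 - t) := by
  have ht' : 0 < 1 - t := sub_pos.2 ht
  have hB0 : 0 ≤ B := by simpa using hB 0
  induction L with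
  | zero => simpa using div_nonneg (mul_nonneg hC hB0) ht'.le
  | succ L ih =>
    rw [Finset.sum_range_succ', h0, add_zero]
    calc ∑ m ∈ Finset.range L, G (m + 1)
        ≤ t * ∑ m ∈ Finset.range L, G m + C * ∑ m ∈ Finset.range L, b m := by
          rw [Finset.mul_sum, Finset.mul_sum, ← Finset.sum_add_distrib]
          exact Finset.sum_le_sum fun m _ => hG m
      _ ≤ t * (C * B / (1 - t)) + C * B :=
          add_le_add (mul_le_mul_of_nonneg_left ih ht0) (mul_le_mul_of_nonneg_left (hB L) hC)
      _ = C * B / (1 - t) := by field_simp; ring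

end SquareSummable

section BlockSum

/-- `blockSum r a m i` is `r ^ m` times the sum of `a` over the `i`-th dyadic interval of
length `2 ^ m`. -/
def blockSum (r : ℝ) (a : ℕ → ℂ) : ℕ → ℕ → ℂ
  | 0, i => a i
  | m + 1, i => r * (blockSum r a m (2 * i) + blockSum r a m (2 * i + 1))

variable (r : ℝ)

lemma blockSum_single (j m i : ℕ) :
    blockSum r (fun i => if i = j then 1 else 0) m i
      = if i = j / 2 ^ m then (r : ℂ) ^ m else 0 := by
  induction m generalizing i with
  | zero => simp [blockSum]
  | succ m ih =>
    have hdiv : j / 2 ^ (m + 1) = j / 2 ^ m / 2 := by rw [pow_succ, Nat.div_div_eq_div_mul]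
    simp only [blockSum, ih, hdiv]
    by_cases h : i = j / 2 ^ m / 2
    · rw [if_pos h]
      rcases Nat.mod_two_eq_zero_or_one (j / 2 ^ m) with h' | h'
      · rw [if_pos (by lia), if_neg (by lia)]; ring
      · rw [if_neg (by lia), if_pos (by lia)]; ring
    · rw [if_neg h, if_neg (by lia), if_neg (by lia)]; ring

/-- Truncation of a sequence to the indices below `n`. -/
def truncate (n : ℕ) (a : ℕ → ℂ) (j : ℕ) : ℂ := if j < n then a j else 0

lemma blockSum_truncate_of_lt (n : ℕ) (a : ℕ → ℂ) (m i : ℕ) (h : i < n / 2 ^ m) :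
    blockSum r (truncate n a) m i = blockSum r a m i := by
  induction m generalizing i with
  | zero => exact if_pos (by simpa using h)
  | succ m ih =>
    rw [pow_succ, ← Nat.div_div_eq_div_mul] at h
    simp only [blockSum, ih (2 * i) (by lia), ih (2 * i + 1) (by lia)]

lemma blockSum_truncate_of_gt (n : ℕ) (a : ℕ → ℂ) (m i : ℕ) (h : n / 2 ^ m < i) :
    blockSum r (truncate n a) m i = 0 := by
  induction m generalizing i with
  | zero => exact if_neg (by simpa using h.le)
  | succ m ih =>
    rw [pow_succ, ← Nat.div_div_eq_div_mul] at h
    simp only [blockSum, ih (2 * i) (by lia), ih (2 * i + 1) (by lia)]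
    simp

lemma blockSum_truncate_succ (n : ℕ) (a : ℕ → ℂ) (m : ℕ) :
    blockSum r (truncate n a) (m + 1) (n / 2 ^ (m + 1)) =
      r * (blockSum r (truncate n a) m (n / 2 ^ m) +
        if n / 2 ^ m % 2 = 1 then blockSum r a m (n / 2 ^ m - 1) else 0) := by
  have hdiv : n / 2 ^ (m + 1) = n / 2 ^ m / 2 := by rw [pow_succ, Nat.div_div_eq_div_mul]
  rw [hdiv, blockSum]
  rcases Nat.mod_two_eq_zero_or_one (n / 2 ^ m) with h | h
  · have h1 : 2 * (n / 2 ^ m / 2) = n / 2 ^ m := by lia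
    rw [h1, if_neg (by lia), blockSum_truncate_of_gt r n a m (n / 2 ^ m + 1) (by lia)]
  · have h1 : 2 * (n / 2 ^ m / 2) = n / 2 ^ m - 1 := by lia
    rw [h1, if_pos h, blockSum_truncate_of_lt r n a m (n / 2 ^ m - 1) (by lia),
      Nat.sub_add_cancel (by lia), add_comm]

/-- The part of the square norm that truncation may create is controlled by a discrete Hardy
inequality with geometric weights. -/
lemma sum_range_sq_blockSum_truncate_le (hr : r ^ 2 < 1) (n : ℕ) (a : ℕ → ℂ) {B : ℝ}
    (hB : ∀ s : Finset (ℕ × ℕ), ∑ p ∈ s, ‖blockSum r a p.1 p.2‖ ^ 2 ≤ B) (L : ℕ) :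
    ∑ m ∈ Finset.range L, ‖blockSum r (truncate n a) m (n / 2 ^ m)‖ ^ 2 ≤
      2 * (1 + r ^ 2) / (1 - r ^ 2) ^ 2 * B := by
  have hr' : 0 < 1 - r ^ 2 := sub_pos.2 hr
  have key := sum_range_le_of_contraction
    (G := fun m => ‖blockSum r (truncate n a) m (n / 2 ^ m)‖ ^ 2)
    (b := fun m => ‖blockSum r a m (n / 2 ^ m - 1)‖ ^ 2)
    (t := (1 + r ^ 2) / 2) (C := (1 + r ^ 2) / (1 - r ^ 2)) (B := B)
    (by positivity) (by linarith) (by positivity) ?_ ?_ ?_ L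
  · refine key.trans_eq ?_
    have : (1 : ℝ) - (1 + r ^ 2) / 2 = (1 - r ^ 2) / 2 := by ring
    rw [this]
    field_simp
  · intro L
    have h := hB ((Finset.range L).image fun m => (m, n / 2 ^ m - 1))
    rwa [Finset.sum_image fun i _ j _ h => (Prod.ext_iff.1 h).1] at h
  · simp [blockSum, truncate]
  · intro m
    simp only [blockSum_truncate_succ]
    set g := blockSum r (truncate n a) m (n / 2 ^ m)
    set b := blockSum r a m (n / 2 ^ m - 1)
    have h1 : ‖g + if n / 2 ^ m % 2 = 1 then b else 0‖ ≤ ‖g‖ + ‖b‖ := by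
      refine (norm_add_le _ _).trans (add_le_add le_rfl ?_)
      split_ifs <;> simp
    have h2 : ‖(r : ℂ) * (g + if n / 2 ^ m % 2 = 1 then b else 0)‖ ^ 2
        ≤ r ^ 2 * (‖g‖ + ‖b‖) ^ 2 := by
      rw [norm_mul, mul_pow, Complex.norm_real, Real.norm_eq_abs, sq_abs]
      gcongr
    refine h2.trans ?_
    rw [div_mul_eq_mul_div, div_mul_eq_mul_div, div_add_div _ _ two_ne_zero hr'.ne',
      le_div_iff₀ (by positivity)]
    nlinarith [sq_nonneg ((1 - r ^ 2) * ‖g‖ - 2 * r ^ 2 * ‖b‖), sq_nonneg ‖b‖, sq_nonneg ‖g‖,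
      sq_nonneg r, mul_nonneg (sq_nonneg r) (sq_nonneg ‖b‖)]

lemma sum_sq_blockSum_truncate_le (hr : r ^ 2 < 1) (n : ℕ) (a : ℕ → ℂ) {B : ℝ}
    (hB : ∀ s : Finset (ℕ × ℕ), ∑ p ∈ s, ‖blockSum r a p.1 p.2‖ ^ 2 ≤ B)
    (s : Finset (ℕ × ℕ)) :
    ∑ p ∈ s, ‖blockSum r (truncate n a) p.1 p.2‖ ^ 2 ≤
      (1 + 2 * (1 + r ^ 2) / (1 - r ^ 2) ^ 2) * B := by
  have hgraph := sum_graph_le (q := fun m => n / 2 ^ m) (fun m => sq_nonneg _)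
    (sum_range_sq_blockSum_truncate_le r hr n a hB) s
  have hle : ∀ p ∈ s, ‖blockSum r (truncate n a) p.1 p.2‖ ^ 2 ≤ ‖blockSum r a p.1 p.2‖ ^ 2 +
      if p.2 = n / 2 ^ p.1 then ‖blockSum r (truncate n a) p.1 (n / 2 ^ p.1)‖ ^ 2 else 0 := by
    rintro ⟨m, i⟩ -
    rcases lt_trichotomy i (n / 2 ^ m) with h | h | h
    · simp [blockSum_truncate_of_lt r n a m i h, h.ne]
    · simp [← h]
    · simp [blockSum_truncate_of_gt r n a m i h, h.ne']
  refine (Finset.sum_le_sum hle).trans ?_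
  rw [Finset.sum_add_distrib]
  linarith [hB s]

end BlockSum

section DyadicSpace

/-- The Hilbert space of sequences whose weighted dyadic block sums are square summable, realised
as the space of coherent families of block sums. -/
def dyadicSpace (r : ℝ) : Submodule ℂ (lp (fun _ : ℕ × ℕ => ℂ) 2) where
  carrier := {f | ∀ m i, f (m + 1, i) = r * (f (m, 2 * i) + f (m, 2 * i + 1))}
  add_mem' {f g} hf hg m i := by
    simp only [lp.coeFn_add, Pi.add_apply, hf m i, hg m i]; ring
  zero_mem' m i := by simp
  smul_mem' z f hf m i := by
    simp only [lp.coeFn_smul, Pi.smul_apply, hf m i, smul_eq_mul]; ring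

variable {r : ℝ}

lemma isClosed_dyadicSpace : IsClosed (dyadicSpace r : Set (lp (fun _ : ℕ × ℕ => ℂ) 2)) := by
  have hc (p : ℕ × ℕ) : Continuous fun f : lp (fun _ : ℕ × ℕ => ℂ) 2 => f p :=
    (lp.evalCLM ℂ (fun _ : ℕ × ℕ => ℂ) 2 p).continuous
  have : (dyadicSpace r : Set (lp (fun _ : ℕ × ℕ => ℂ) 2)) =
      ⋂ m, ⋂ i, {f | f (m + 1, i) = (r : ℂ) * (f (m, 2 * i) + f (m, 2 * i + 1))} := by
    ext f
    simp only [Set.mem_iInter]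
    rfl
  rw [this]
  exact isClosed_iInter fun m => isClosed_iInter fun i =>
    isClosed_eq (hc _) (continuous_const.mul ((hc _).add (hc _)))

instance completeSpace_dyadicSpace : CompleteSpace (dyadicSpace r) :=
  isClosed_dyadicSpace.completeSpace_coe

/-- The coordinate functionals. -/
noncomputable def coord (j : ℕ) : dyadicSpace r →L[ℂ] ℂ :=
  (lp.evalCLM ℂ (fun _ : ℕ × ℕ => ℂ) 2 (0, j)).comp (dyadicSpace r).subtypeL

lemma coord_apply (j : ℕ) (f : dyadicSpace r) : coord j f = f.1 (0, j) := rfl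

lemma apply_eq_blockSum (f : dyadicSpace r) (m i : ℕ) :
    f.1 (m, i) = blockSum r (fun j => coord j f) m i := by
  induction m generalizing i with
  | zero => rfl
  | succ m ih => rw [f.2 m i, ih, ih, blockSum]

lemma ext_coord (f g : dyadicSpace r) (h : ∀ j, coord j f = coord j g) : f = g := by
  refine Subtype.ext (lp.ext (funext fun p => ?_))
  rw [apply_eq_blockSum f p.1 p.2, apply_eq_blockSum g p.1 p.2]
  simp only [h]

/-- The element of the space with given coordinates. -/
def ofCoord (a : ℕ → ℂ) (ha : Memℓp (fun p : ℕ × ℕ => blockSum r a p.1 p.2) 2) :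
    dyadicSpace r :=
  ⟨⟨fun p => blockSum r a p.1 p.2, ha⟩, fun _ _ => rfl⟩

lemma sum_sq_blockSum_coord_le (f : dyadicSpace r) (s : Finset (ℕ × ℕ)) :
    ∑ p ∈ s, ‖blockSum r (fun j => coord j f) p.1 p.2‖ ^ 2 ≤ ‖f‖ ^ 2 := by
  simp only [← apply_eq_blockSum]
  exact sum_sq_le_norm_sq f.1 s

/-- Truncation to the coordinates below `n`. -/
noncomputable def truncateCLM (hr : r ^ 2 < 1) (n : ℕ) : dyadicSpace r →L[ℂ] dyadicSpace r :=
  LinearMap.mkContinuous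
    { toFun := fun f => ofCoord (truncate n fun j => coord j f)
        (memℓp_two_of_sum_le
          (sum_sq_blockSum_truncate_le r hr n _ (sum_sq_blockSum_coord_le f)))
      map_add' := fun f g => ext_coord _ _ fun j => by
        simp only [map_add]
        simp only [coord_apply, ofCoord, blockSum, truncate]
        split_ifs <;> simp
      map_smul' := fun z f => ext_coord _ _ fun j => by
        simp only [map_smul, RingHom.id_apply]
        simp only [coord_apply, ofCoord, blockSum, truncate]
        split_ifs <;> simp }
    (1 + 2 * (1 + r ^ 2) / (1 - r ^ 2) ^ 2)
    (fun f => norm_le_of_sum_sq_le (by positivity) fun s => by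
      refine (sum_sq_blockSum_truncate_le r hr n _ (sum_sq_blockSum_coord_le f) s).trans ?_
      rw [mul_pow]
      refine mul_le_mul_of_nonneg_right ?_ (sq_nonneg _)
      have h : 0 ≤ 2 * (1 + r ^ 2) / (1 - r ^ 2) ^ 2 := by positivity
      exact le_self_pow₀ (by linarith) two_ne_zero)

lemma norm_truncateCLM_le (hr : r ^ 2 < 1) (n : ℕ) :
    ‖truncateCLM hr n‖ ≤ 1 + 2 * (1 + r ^ 2) / (1 - r ^ 2) ^ 2 :=
  LinearMap.mkContinuous_norm_le _ (by positivity) _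

lemma coord_truncateCLM (hr : r ^ 2 < 1) (j n : ℕ) (f : dyadicSpace r) :
    coord j (truncateCLM hr n f) = if j < n then coord j f else 0 := rfl

lemma sum_sq_blockSum_single_le (hr : r ^ 2 < 1) (j : ℕ) (s : Finset (ℕ × ℕ)) :
    ∑ p ∈ s, ‖blockSum r (fun i => if i = j then 1 else 0) p.1 p.2‖ ^ 2 ≤ (1 - r ^ 2)⁻¹ := by
  have h := sum_graph_le (G := fun m => (r ^ 2) ^ m) (q := fun m => j / 2 ^ m)
    (C := (1 - r ^ 2)⁻¹) (fun m => by positivity)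
    (fun L => by
      rw [← tsum_geometric_of_lt_one (sq_nonneg r) hr]
      exact (summable_geometric_of_lt_one (sq_nonneg r) hr).sum_le_tsum _
        fun _ _ => by positivity) s
  refine le_of_eq_of_le (Finset.sum_congr rfl fun p _ => ?_) h
  rw [blockSum_single]
  split_ifs
  · rw [norm_pow, Complex.norm_real, Real.norm_eq_abs, pow_right_comm, sq_abs]
  · simp

/-- The unit vectors. -/
noncomputable def unitVec (hr : r ^ 2 < 1) (j : ℕ) : dyadicSpace r :=
  ofCoord (fun i => if i = j then 1 else 0)
    (memℓp_two_of_sum_le (sum_sq_blockSum_single_le hr j))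

lemma coord_unitVec (hr : r ^ 2 < 1) (i j : ℕ) :
    coord i (unitVec hr j) = if i = j then 1 else 0 := rfl

lemma norm_unitVec_le (hr : r ^ 2 < 1) (j : ℕ) : ‖unitVec hr j‖ ≤ (1 - r ^ 2)⁻¹ := by
  have hpos : 0 < 1 - r ^ 2 := sub_pos.2 hr
  refine norm_le_of_sum_sq_le (by positivity) fun s =>
    (sum_sq_blockSum_single_le hr j s).trans (le_self_pow₀ ?_ two_ne_zero)
  exact (one_le_inv₀ hpos).2 (by nlinarith [sq_nonneg r])

lemma pow_le_norm_sum_unitVec (hr : r ^ 2 < 1) (hr0 : 0 ≤ r) (k : ℕ) :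
    (2 * r) ^ k ≤ ‖∑ j ∈ Finset.Ico (2 ^ k) (2 ^ k + 2 ^ k), unitVec hr j‖ := by
  set f := ∑ j ∈ Finset.Ico (2 ^ k) (2 ^ k + 2 ^ k), unitVec hr j with hf
  have h : f.1 (k, 1) = (2 * r) ^ k := by
    have h1 : f.1 (k, 1) = ∑ j ∈ Finset.Ico (2 ^ k) (2 ^ k + 2 ^ k), (unitVec hr j).1 (k, 1) := by
      rw [hf, Submodule.coe_sum, lp.coeFn_sum, Finset.sum_apply]
    have h2 : ∀ j ∈ Finset.Ico (2 ^ k) (2 ^ k + 2 ^ k), (unitVec hr j).1 (k, 1) = (r : ℂ) ^ k := by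
      intro j hj
      rw [Finset.mem_Ico] at hj
      refine (blockSum_single r j k 1).trans (if_pos ?_)
      symm
      rw [Nat.div_eq_iff (by positivity)]
      lia
    rw [h1, Finset.sum_congr rfl h2]
    simp [mul_pow]
  have hn := lp.norm_apply_le_norm (p := 2) two_ne_zero f.1 (k, 1)
  rw [h] at hn
  refine le_of_eq_of_le ?_ hn
  rw [norm_pow, norm_mul, Complex.norm_real, Real.norm_of_nonneg hr0]
  simp

lemma not_finiteDimensional_dyadicSpace (hr : r ^ 2 < 1) :
    ¬FiniteDimensional ℂ (dyadicSpace r) := by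
  intro hfin
  have hli : LinearIndependent ℂ (unitVec hr) := by
    rw [linearIndependent_iff']
    intro s g hg i hi
    have h := congrArg (coord i) hg
    simpa [coord_unitVec, hi] using h
  have := hli.finite
  exact not_finite ℕ

end DyadicSpace

section Similarity

variable {H : Type*} [NormedAddCommGroup H] [InnerProductSpace ℂ H] [CompleteSpace H]

/-- Let `P` be a uniformly bounded chain of truncations along the coordinates `φ`, with bounded
biorthogonal vectors `e` whose sums over dyadic blocks of length `2 ^ k` grow like `(2 * r) ^ k`.
If `r` is close enough to `1` in terms of `c`, then no operator similar to
`diagonalOp P eigenvalue` has all its powers bounded by `c`. -/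
lemma exists_lt_norm_conj_pow {P : ℕ → H →L[ℂ] H} {φ : ℕ → H →L[ℂ] ℂ} {e : ℕ → H}
    {c r M E : ℝ} (hc : 0 ≤ c) (hr0 : 0 ≤ r) (hr : 4 - 1 / (c + 1) ^ 2 < 4 * r ^ 2)
    (hP : ∀ n, ‖P n‖ ≤ M) (hφP : ∀ j n x, φ j (P n x) = if j < n then φ j x else 0)
    (hφ : ∀ x y, (∀ j, φ j x = φ j y) → x = y)
    (he : ∀ i j, φ i (e j) = if i = j then 1 else 0) (hE : ∀ j, ‖e j‖ ≤ E)
    (hlow : ∀ k, (2 * r) ^ k ≤ ‖∑ j ∈ Finset.Ico (2 ^ k) (2 ^ k + 2 ^ k), e j‖)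
    (A : (H →L[ℂ] H)ˣ) :
    ∃ n : ℕ, c < ‖((↑A⁻¹ : H →L[ℂ] H) * diagonalOp P eigenvalue * ↑A) ^ n‖ := by
  by_contra! hA
  set b : ℝ := c + 1 with hb
  have hb1 : 1 ≤ b := by linarith
  have hb3 : 1 / b ^ 2 ≤ 1 := by
    rw [div_le_one (by positivity)]
    exact one_le_pow₀ hb1
  have hpow := diagonalOp_pow hP hφP hφ eigenvalue_monotone (eigenvalue_nonneg 0)
    tendsto_eigenvalue
  set A₁ : H →L[ℂ] H := ↑A
  set A₂ : H →L[ℂ] H := ↑A⁻¹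
  have hA21 : A₂ * A₁ = 1 := A.inv_mul
  have hA12 : A₁ * A₂ = 1 := A.mul_inv
  have hconj (k : ℕ) : (A₂ * diagonalOp P eigenvalue * A₁) ^ k =
      A₂ * (diagonalOp P eigenvalue) ^ k * A₁ := A.conj_pow' _ k
  have hM : 0 ≤ M := (norm_nonneg _).trans (hP 0)
  obtain ⟨n₀, hn₀⟩ := exists_nat_ge (‖A₂‖ * (2 * M * 2) * ‖A₁‖)
  have hR : ∀ n, n₀ + 1 ≤ n → ‖1 - A₂ * P n * A₁‖ ≤ b := by
    intro n hn
    obtain ⟨n, rfl⟩ : ∃ n', n = n' + 1 := ⟨n - 1, by lia⟩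
    obtain ⟨k, hk⟩ := exists_pow_eigenvalue_gap n
    have h1 := norm_one_sub_sub_diagonalOp_le hP (eigenvalue_pow_monotone k)
      (pow_nonneg (eigenvalue_nonneg 0) k) (tendsto_eigenvalue_pow k) n
    rw [← hpow] at h1
    have h2 : 1 - A₂ * P (n + 1) * A₁ = (A₂ * diagonalOp P eigenvalue * A₁) ^ k +
        A₂ * ((1 - P (n + 1)) - diagonalOp P eigenvalue ^ k) * A₁ := by
      rw [hconj, mul_sub, mul_sub, sub_mul, sub_mul, mul_one, hA21]
      abel
    have hn1 : (0 : ℝ) < n + 1 := by positivity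
    have hn2 : (n₀ : ℝ) ≤ n + 1 := by exact_mod_cast (by lia : n₀ ≤ n + 1)
    rw [h2, hb]
    refine (norm_add_le _ _).trans (add_le_add (hA k) ?_)
    calc ‖A₂ * ((1 - P (n + 1)) - diagonalOp P eigenvalue ^ k) * A₁‖
        ≤ ‖A₂‖ * (2 * M * (2 / (n + 1))) * ‖A₁‖ := by
          refine (norm_mul_le _ _).trans (mul_le_mul_of_nonneg_right ?_ (norm_nonneg _))
          refine (norm_mul_le _ _).trans (mul_le_mul_of_nonneg_left ?_ (norm_nonneg _))
          exact h1.trans (mul_le_mul_of_nonneg_left hk (by positivity))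
      _ = ‖A₂‖ * (2 * M * 2) * ‖A₁‖ / (n + 1) := by ring
      _ ≤ 1 := by rw [div_le_one hn1]; linarith
  set K : ℝ := ‖A₂‖ * E
  have hup := norm_sum_block_sq_le (R := fun n => A₂ * P n * A₁) (y := fun j => A₂ (e j))
    (K := K) hb1 hR
    (fun n j => by
      have h1 : A₁ (A₂ (e j)) = e j := by
        rw [← mul_apply_eq_comp, hA12, one_apply_eq_self]
      have h2 : P n (e j) = if j < n then e j else 0 := by
        refine hφ _ _ fun i => ?_
        rw [hφP]
        by_cases hij : i = j
        · subst hij; split_ifs <;> simp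
        · split_ifs <;> simp [he, hij]
      rw [mul_apply_eq_comp, mul_apply_eq_comp, h1, h2]
      split_ifs <;> simp)
    (fun j => A₂.le_opNorm_of_le (hE j))
  have hle (k : ℕ) (hk : n₀ + 1 ≤ 2 ^ k) :
      ((4 * r ^ 2) / (4 - 1 / b ^ 2)) ^ k ≤ ‖A₁‖ ^ 2 * K ^ 2 := by
    have h1 := hup k (2 ^ k) hk
    rw [← map_sum] at h1
    set x := ∑ j ∈ Finset.Ico (2 ^ k) (2 ^ k + 2 ^ k), e j
    have h2 : (2 * r) ^ k ≤ ‖A₁‖ * ‖A₂ x‖ := by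
      refine (hlow k).trans ?_
      have : x = A₁ (A₂ x) := by rw [← mul_apply_eq_comp, hA12, one_apply_eq_self]
      exact (congrArg norm this).le.trans (A₁.le_opNorm _)
    have h3 := pow_le_pow_left₀ (by positivity) h2 2
    have h4 : (4 * r ^ 2) ^ k = ((2 * r) ^ k) ^ 2 := by rw [pow_right_comm]; ring
    have h5 : 0 < (4 - 1 / b ^ 2) ^ k := pow_pos (by linarith) k
    rw [div_pow, div_le_iff₀ h5, h4]
    calc ((2 * r) ^ k) ^ 2 ≤ ‖A₁‖ ^ 2 * ‖A₂ x‖ ^ 2 := by rwa [← mul_pow]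
      _ ≤ ‖A₁‖ ^ 2 * ((4 - 1 / b ^ 2) ^ k * K ^ 2) :=
          mul_le_mul_of_nonneg_left h1 (sq_nonneg _)
      _ = ‖A₁‖ ^ 2 * K ^ 2 * (4 - 1 / b ^ 2) ^ k := by ring
  have hgt : 1 < (4 * r ^ 2) / (4 - 1 / b ^ 2) := by
    rwa [one_lt_div (by linarith)]
  have htend := tendsto_pow_atTop_atTop_of_one_lt hgt
  obtain ⟨k, hk1, hk2⟩ := ((htend.eventually_gt_atTop (‖A₁‖ ^ 2 * K ^ 2)).and
    (eventually_ge_atTop (n₀ + 1))).exists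
  exact (hle k (hk2.trans Nat.lt_two_pow_self.le)).not_gt hk1

end Similarity

end PellerCounterexample

open PellerCounterexample

/-- **Solution of Peller's problem** (Kalton–Le Merdy).  For every `c > 1` there is a
power-bounded operator `T` on an infinite-dimensional complex Hilbert space such that every
operator similar to `T` has some power of norm exceeding `c`. -/
theorem peller_counterexample (c : ℝ) (hc : 1 < c) :
    ∃ (H : Type) (_ : NormedAddCommGroup H) (_ : InnerProductSpace ℂ H)
      (_ : CompleteSpace H), ¬FiniteDimensional ℂ H ∧
      ∃ T : H →L[ℂ] H, (∃ M : ℝ, ∀ n : ℕ, ‖T ^ n‖ ≤ M) ∧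
        ∀ A : (H →L[ℂ] H)ˣ, ∃ n : ℕ, c < ‖((↑A⁻¹ : H →L[ℂ] H) * T * ↑A) ^ n‖ := by
  have hb : 0 < 1 / (c + 1) ^ 2 := by positivity
  have hb1 : 1 / (c + 1) ^ 2 ≤ 1 := by
    rw [div_le_one (by positivity)]
    exact one_le_pow₀ (by linarith)
  obtain ⟨r, hr0, hrsq⟩ : ∃ r : ℝ, 0 ≤ r ∧ r ^ 2 = 1 - 1 / (c + 1) ^ 2 / 8 :=
    ⟨_, Real.sqrt_nonneg _, Real.sq_sqrt (by linarith)⟩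
  have hr : r ^ 2 < 1 := by linarith
  have hP := norm_truncateCLM_le hr
  refine ⟨dyadicSpace r, inferInstance, inferInstance, inferInstance,
    not_finiteDimensional_dyadicSpace hr, diagonalOp (truncateCLM hr) eigenvalue,
    ⟨1 + (1 + 2 * (1 + r ^ 2) / (1 - r ^ 2) ^ 2), fun k => ?_⟩,
    exists_lt_norm_conj_pow (by linarith) hr0 (by linarith) hP
      (coord_truncateCLM hr) ext_coord (coord_unitVec hr) (norm_unitVec_le hr)
      (pow_le_norm_sum_unitVec hr hr0)⟩
  rw [diagonalOp_pow hP (coord_truncateCLM hr) ext_coord eigenvalue_monotone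
    (eigenvalue_nonneg 0) tendsto_eigenvalue]
  exact norm_diagonalOp_le hP (eigenvalue_pow_monotone k) (pow_nonneg (eigenvalue_nonneg 0) k)
    (tendsto_eigenvalue_pow k)
end

section
/- If P is a bounded projection on a Hilbert space H with P ≠ 0 and P ≠ I, then ‖P‖ = ‖I − P‖. -/
/-- Swapping the lengths of two vectors, while keeping their directions, does not change the norm
of their sum (stated without division). -/
theorem norm_norm_sq_smul_add_norm_sq_smul {E : Type*} [NormedAddCommGroup E]
    [InnerProductSpace ℂ E] (u v : E) :
    ‖((‖v‖ ^ 2 : ℝ) : ℂ) • u + ((‖u‖ ^ 2 : ℝ) : ℂ) • v‖ = ‖u‖ * ‖v‖ * ‖u + v‖ := by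
  rw [← sq_eq_sq₀ (norm_nonneg _) (by positivity), mul_pow, norm_add_sq (𝕜 := ℂ),
    norm_add_sq (𝕜 := ℂ), inner_smul_left, inner_smul_right, norm_smul, norm_smul,
    Complex.conj_ofReal, ← mul_assoc, ← Complex.ofReal_mul, Complex.norm_real, Complex.norm_real,
    Real.norm_of_nonneg (by positivity), Real.norm_of_nonneg (by positivity)]
  simp only [RCLike.re_to_complex, Complex.re_ofReal_mul]
  ring

/-- A nonzero idempotent in a normed ring has norm at least one. -/
theorem IsIdempotentElem.one_le_norm {R : Type*} [NormedRing R] {p : R}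
    (hp : IsIdempotentElem p) (h0 : p ≠ 0) : 1 ≤ ‖p‖ := by
  have h := norm_mul_le p p
  rw [hp.eq] at h
  exact le_of_mul_le_mul_right (by simpa using h) (norm_pos_iff.mpr h0)

theorem IsIdempotentElem.norm_one_sub_le {H : Type*} [NormedAddCommGroup H]
    [InnerProductSpace ℂ H] {P : H →L[ℂ] H} (hP : IsIdempotentElem P) (h0 : P ≠ 0) :
    ‖1 - P‖ ≤ ‖P‖ := by
  refine ContinuousLinearMap.opNorm_le_bound _ (norm_nonneg _) fun x => ?_
  have hPP : P (P x) = P x := congrArg (fun T : H →L[ℂ] H => T x) hP.eq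
  have hQ : (1 - P) x = x - P x := rfl
  rw [hQ]
  rcases eq_or_ne (P x) 0 with hu | hu
  · rw [hu, sub_zero]
    exact le_mul_of_one_le_left (norm_nonneg _) (hP.one_le_norm h0)
  rcases eq_or_ne (x - P x) 0 with hv | hv
  · rw [hv, norm_zero]
    positivity
  have hle := P.le_opNorm
    (((‖x - P x‖ ^ 2 : ℝ) : ℂ) • P x + ((‖P x‖ ^ 2 : ℝ) : ℂ) • (x - P x))
  rw [norm_norm_sq_smul_add_norm_sq_smul, map_add, map_smul, map_smul, map_sub, hPP, sub_self,
    smul_zero, add_zero, norm_smul, Complex.norm_real, Real.norm_of_nonneg (by positivity),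
    add_sub_cancel] at hle
  have hpos : 0 < ‖P x‖ * ‖x - P x‖ := mul_pos (norm_pos_iff.mpr hu) (norm_pos_iff.mpr hv)
  refine le_of_mul_le_mul_left ?_ hpos
  linarith

/-- If `P` is a nontrivial bounded projection on a Hilbert space then `‖P‖ = ‖1 - P‖`. -/
theorem norm_projection_eq_norm_one_sub {H : Type*} [NormedAddCommGroup H]
    [InnerProductSpace ℂ H] [CompleteSpace H] (P : H →L[ℂ] H)
    (hproj : P * P = P) (h0 : P ≠ 0) (h1 : P ≠ 1) :
    ‖P‖ = ‖1 - P‖ := by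
  have hP : IsIdempotentElem P := hproj
  refine le_antisymm ?_ (hP.norm_one_sub_le h0)
  simpa using hP.one_sub.norm_one_sub_le (sub_ne_zero.mpr h1.symm)
end

section
/- Let H be a Hilbert space, (e_k)_{k≥0} a sequence in H with dense linear span, and (P_n)_{n≥0} bounded projections on H with P_n e_k = e_k for k ≤ n and P_n e_k = 0 for k > n, satisfying b := sup_n ‖P_n‖ < ∞. Let (λ_k)_{k≥0} be a nondecreasing sequence with 0 ≤ λ_k ≤ 1. Then there exists a bounded operator T on H with T e_k = λ_k e_k for all k, and this T satisfies ‖T^n‖ ≤ b for every n ≥ 0. -/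
/-- In an inner product space, swapping the lengths of two nonzero vectors does not change the
norm of their sum. -/
theorem norm_swap_smul_add_smul {H : Type*} [NormedAddCommGroup H] [InnerProductSpace ℂ H]
    {u v : H} (hu : u ≠ 0) (hv : v ≠ 0) :
    ‖((‖v‖ / ‖u‖ : ℝ) : ℂ) • u + ((‖u‖ / ‖v‖ : ℝ) : ℂ) • v‖ = ‖u + v‖ := by
  have hu' : ‖u‖ ≠ 0 := norm_ne_zero_iff.mpr hu
  have hv' : ‖v‖ ≠ 0 := norm_ne_zero_iff.mpr hv
  have hc : (starRingEnd ℂ) ((‖v‖ / ‖u‖ : ℝ) : ℂ) * ((‖u‖ / ‖v‖ : ℝ) : ℂ) = 1 := by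
    rw [Complex.conj_ofReal, ← Complex.ofReal_mul, ← Complex.ofReal_one]
    congr 1
    field_simp
  rw [← sq_eq_sq₀ (norm_nonneg _) (norm_nonneg _), @norm_add_sq ℂ, @norm_add_sq ℂ,
    inner_smul_left, inner_smul_right, ← mul_assoc, hc, one_mul, norm_smul, norm_smul,
    Complex.norm_real, Complex.norm_real, Real.norm_of_nonneg (by positivity),
    Real.norm_of_nonneg (by positivity), div_mul_cancel₀ _ hu', div_mul_cancel₀ _ hv']
  ring

/-- The complement of a bounded idempotent on an inner product space obeys the same norm bound,
provided the bound is at least one. -/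
theorem norm_one_sub_le_of_idempotent {H : Type*} [NormedAddCommGroup H] [InnerProductSpace ℂ H]
    {Q : H →L[ℂ] H} (hQ : Q * Q = Q) {b : ℝ} (hb1 : 1 ≤ b) (hb : ‖Q‖ ≤ b) : ‖1 - Q‖ ≤ b := by
  have hb0 : 0 ≤ b := zero_le_one.trans hb1
  refine ContinuousLinearMap.opNorm_le_bound _ hb0 fun x => ?_
  have hQQ : Q (Q x) = Q x := congrArg (fun S : H →L[ℂ] H => S x) hQ
  have hv : (1 - Q) x = x - Q x := rfl
  rw [hv]
  rcases eq_or_ne (Q x) 0 with hu0 | hu0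
  · rw [hu0, sub_zero]
    exact le_mul_of_one_le_left (norm_nonneg x) hb1
  rcases eq_or_ne (x - Q x) 0 with hv0 | hv0
  · rw [hv0, norm_zero]
    positivity
  have hswap := norm_swap_smul_add_smul hu0 hv0
  rw [add_sub_cancel] at hswap
  have hle := Q.le_of_opNorm_le hb
    (((‖x - Q x‖ / ‖Q x‖ : ℝ) : ℂ) • Q x + ((‖Q x‖ / ‖x - Q x‖ : ℝ) : ℂ) • (x - Q x))
  rwa [hswap, map_add, map_smul, map_smul, map_sub, hQQ, sub_self, smul_zero, add_zero, norm_smul,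
    Complex.norm_real, Real.norm_of_nonneg (by positivity),
    div_mul_cancel₀ _ (norm_ne_zero_iff.mpr hu0)] at hle

/-- If complements `1 - P n` of partial sum projections are bounded by `b ≥ 1`, then every monotone
multiplier with values in `[0, 1]` is bounded by `b`. -/
theorem exists_monotone_multiplier {H : Type*} [NormedAddCommGroup H]
    [NormedSpace ℂ H] [CompleteSpace H] (e : ℕ → H) (P : ℕ → H →L[ℂ] H)
    (hP1 : ∀ n k, k ≤ n → P n (e k) = e k) (hP2 : ∀ n k, n < k → P n (e k) = 0)
    (b : ℝ) (hb1 : 1 ≤ b) (hb : ∀ n, ‖1 - P n‖ ≤ b)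
    (l : ℕ → ℝ) (hmono : Monotone l) (hl0 : ∀ k, 0 ≤ l k) (hl1 : ∀ k, l k ≤ 1) :
    ∃ T : H →L[ℂ] H, (∀ k, T (e k) = (l k : ℂ) • e k) ∧ ‖T‖ ≤ b := by
  have hb0 : 0 ≤ b := zero_le_one.trans hb1
  have hd : ∀ k, 0 ≤ l (k + 1) - l k := fun k => sub_nonneg.mpr (hmono k.le_succ)
  have hpartial : ∀ n, ∑ k ∈ Finset.range n, (l (k + 1) - l k) ≤ 1 - l 0 := fun n => by
    rw [Finset.sum_range_sub]
    linarith [hl1 n]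
  have hsd : Summable fun k => l (k + 1) - l k := summable_of_sum_range_le hd hpartial
  set F : ℕ → H →L[ℂ] H := fun k => ((l (k + 1) - l k : ℝ) : ℂ) • (1 - P k) with hF
  have hFb : ∀ k, ‖F k‖ ≤ (l (k + 1) - l k) * b := fun k => by
    rw [hF, norm_smul, Complex.norm_real, Real.norm_of_nonneg (hd k)]
    exact mul_le_mul_of_nonneg_left (hb k) (hd k)
  have hsF : Summable F := .of_norm_bounded (hsd.mul_right b) hFb
  refine ⟨(l 0 : ℂ) • 1 + ∑' k, F k, fun k => ?_, ?_⟩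
  · have happ : (∑' j, F j) (e k) = ∑' j, F j (e k) :=
      (ContinuousLinearMap.apply ℂ H (e k)).map_tsum hsF
    have htail : ∀ j ∉ Finset.range k, F j (e k) = 0 := fun j hj => by
      simp [hF, hP1 j k (by simpa using hj)]
    have hhead : ∀ j ∈ Finset.range k, F j (e k) = ((l (j + 1) - l j : ℝ) : ℂ) • e k :=
      fun j hj => by simp [hF, hP2 j k (by simpa using hj)]
    rw [add_apply, happ, tsum_eq_sum htail, Finset.sum_congr rfl hhead,
      ← Finset.sum_smul, ← Complex.ofReal_sum, Finset.sum_range_sub]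
    change (l 0 : ℂ) • e k + _ = _
    rw [← add_smul, ← Complex.ofReal_add, add_sub_cancel]
  · have h0 : ‖(l 0 : ℂ) • (1 : H →L[ℂ] H)‖ ≤ l 0 := by
      rw [norm_smul, Complex.norm_real, Real.norm_of_nonneg (hl0 0)]
      exact mul_le_of_le_one_right (hl0 0) ContinuousLinearMap.norm_id_le
    have h1 : ‖∑' k, F k‖ ≤ (1 - l 0) * b := by
      refine (tsum_of_norm_bounded (hsd.mul_right b).hasSum hFb).trans ?_
      rw [tsum_mul_right]
      exact mul_le_mul_of_nonneg_right (Real.tsum_le_of_sum_range_le hd hpartial) hb0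
    calc ‖(l 0 : ℂ) • (1 : H →L[ℂ] H) + ∑' k, F k‖ ≤ l 0 + (1 - l 0) * b :=
          (norm_add_le _ _).trans (add_le_add h0 h1)
      _ ≤ b := by nlinarith [mul_nonneg (hl0 0) (sub_nonneg.mpr hb1)]

/-- A monotone multiplier with respect to a Schauder basis with basis constant (at most) `b`
is well-defined and power-bounded by `b`. -/
theorem monotone_multiplier_power_bounded {H : Type*} [NormedAddCommGroup H]
    [InnerProductSpace ℂ H] [CompleteSpace H]
    (e : ℕ → H) (hdense : Dense (Submodule.span ℂ (Set.range e) : Set H))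
    (P : ℕ → H →L[ℂ] H) (hproj : ∀ n, P n * P n = P n)
    (hP1 : ∀ n k, k ≤ n → P n (e k) = e k) (hP2 : ∀ n k, n < k → P n (e k) = 0)
    (b : ℝ) (hb : ∀ n, ‖P n‖ ≤ b)
    (l : ℕ → ℝ) (hmono : Monotone l) (hl0 : ∀ k, 0 ≤ l k) (hl1 : ∀ k, l k ≤ 1) :
    ∃ T : H →L[ℂ] H, (∀ k, T (e k) = (l k : ℂ) • e k) ∧ ∀ n : ℕ, ‖T ^ n‖ ≤ b := by
  have hext : ∀ S T : H →L[ℂ] H, (∀ k, S (e k) = T (e k)) → S = T := fun S T h =>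
    ContinuousLinearMap.ext_on hdense (by rintro _ ⟨k, rfl⟩; exact h k)
  by_cases he : ∀ k, e k = 0
  · have hzero : ∀ S : H →L[ℂ] H, S = 0 := fun S => hext S 0 fun k => by simp [he k]
    refine ⟨0, fun k => by simp [he k], fun n => ?_⟩
    rw [hzero (0 ^ n), norm_zero]
    exact (norm_nonneg _).trans (hb 0)
  push Not at he
  obtain ⟨m, hm⟩ := he
  have hb1 : 1 ≤ b := by
    have h := (P m).le_of_opNorm_le (hb m) (e m)
    rw [hP1 m m le_rfl] at h
    exact (le_mul_iff_one_le_left (norm_pos_iff.mpr hm)).mp h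
  have hmult := exists_monotone_multiplier e P hP1 hP2 b hb1
    fun n => norm_one_sub_le_of_idempotent (hproj n) hb1 (hb n)
  obtain ⟨T, hT, -⟩ := hmult l hmono hl0 hl1
  refine ⟨T, hT, fun n => ?_⟩
  obtain ⟨S, hS, hSb⟩ := hmult (fun k => l k ^ n)
    (fun i j hij => pow_le_pow_left₀ (hl0 i) (hmono hij) n)
    (fun k => pow_nonneg (hl0 k) n) (fun k => pow_le_one₀ (hl0 k) (hl1 k))
  have hpow : ∀ (i k : ℕ), (T ^ i) (e k) = ((l k ^ i : ℝ) : ℂ) • e k := fun i k => by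
    induction i with
    | zero => simp
    | succ i ih =>
      rw [pow_succ, mul_apply_eq_comp, hT, map_smul, ih, smul_smul,
        ← Complex.ofReal_mul, pow_succ']
  rwa [hext (T ^ n) S fun k => (hpow n k).trans (hS k).symm]
end

section
/- Let H be a Hilbert space, (e_k)_{k≥0} a sequence with dense linear span, (P_n)_{n≥0} bounded projections with P_n e_k = e_k for k ≤ n, P_n e_k = 0 for k > n, and b := sup_n ‖P_n‖ < ∞; set Q_n = I − P_n. Let T be the bounded operator with T e_k = λ_k e_k, where (λ_k) is nondecreasing, 0 ≤ λ_k < 1 for all k, and lim_{k→∞}(1 − λ_k)/(1 − λ_{k−1}) = 0. Then there exists an increasing sequence of positive integers (N_n)_{n≥0} such that lim_{n→∞} ‖T^{N_n} − Q_n‖ = 0. -/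
open Filter Topology

/-- An operator acting diagonally, with multipliers of bounded variation, on a sequence with dense
span and uniformly bounded partial sum projections is controlled by the variation. -/
theorem norm_le_of_diagonal_of_variation_le {H : Type*} [NormedAddCommGroup H] [NormedSpace ℂ H]
    {e : ℕ → H} (hdense : Dense (Submodule.span ℂ (Set.range e) : Set H))
    {P : ℕ → H →L[ℂ] H}
    (hP1 : ∀ n k, k ≤ n → P n (e k) = e k) (hP2 : ∀ n k, n < k → P n (e k) = 0)
    {b : ℝ} (hb : ∀ n, ‖P n‖ ≤ b) {A : H →L[ℂ] H} {f : ℕ → ℝ}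
    (hA : ∀ k, A (e k) = (f k : ℂ) • e k) {C : ℝ}
    (hC : ∀ m, |f m| + ∑ k ∈ Finset.range m, |f k - f (k + 1)| ≤ C) :
    ‖A‖ ≤ C * b := by
  have hb0 : 0 ≤ b := (norm_nonneg _).trans (hb 0)
  have hC0 : 0 ≤ C := le_trans (by positivity) (hC 0)
  let B : ℕ → H →L[ℂ] H := fun m =>
    (f m : ℂ) • P m + ∑ k ∈ Finset.range m, ((f k - f (k + 1) : ℝ) : ℂ) • P k
  have hB_norm : ∀ m, ‖B m‖ ≤ C * b := fun m => by
    calc ‖B m‖ ≤ |f m| * b + ∑ k ∈ Finset.range m, |f k - f (k + 1)| * b := by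
          refine (norm_add_le _ _).trans (add_le_add ?_ ((norm_sum_le _ _).trans ?_))
          · rw [norm_smul, Complex.norm_real, Real.norm_eq_abs]
            exact mul_le_mul_of_nonneg_left (hb m) (abs_nonneg _)
          · refine Finset.sum_le_sum fun k _ => ?_
            rw [norm_smul, Complex.norm_real, Real.norm_eq_abs]
            exact mul_le_mul_of_nonneg_left (hb k) (abs_nonneg _)
      _ = (|f m| + ∑ k ∈ Finset.range m, |f k - f (k + 1)|) * b := by
          rw [add_mul, Finset.sum_mul]
      _ ≤ C * b := mul_le_mul_of_nonneg_right (hC m) hb0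
  have hB_apply : ∀ j m, j ≤ m → B m (e j) = A (e j) := by
    intro j m hjm
    rw [hA]
    induction m, hjm using Nat.le_induction with
    | base =>
      simp only [B, add_apply, sum_apply,
        smul_apply, hP1 j j le_rfl]
      rw [Finset.sum_eq_zero, add_zero]
      intro k hk
      rw [hP2 k j (Finset.mem_range.mp hk), smul_zero]
    | succ m hm ih =>
      rw [← ih]
      simp only [B, add_apply, sum_apply,
        smul_apply, Finset.sum_range_succ, hP1 m j hm,
        hP1 (m + 1) j (hm.trans m.le_succ)]
      push_cast
      module
  have hspan : ∀ x ∈ Submodule.span ℂ (Set.range e), ∀ᶠ m in atTop, B m x = A x := by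
    intro x hx
    induction hx using Submodule.span_induction with
    | mem x hx =>
      obtain ⟨j, rfl⟩ := hx
      filter_upwards [eventually_ge_atTop j] with m hm using hB_apply j m hm
    | zero => simp
    | add x y _ _ hx hy =>
      filter_upwards [hx, hy] with m h1 h2
      rw [map_add, map_add, h1, h2]
    | smul c x _ hx =>
      filter_upwards [hx] with m h
      rw [map_smul, map_smul, h]
  refine A.opNorm_le_bound (mul_nonneg hC0 hb0) fun x => ?_
  have hclosed : IsClosed {x : H | ‖A x‖ ≤ C * b * ‖x‖} :=
    isClosed_le (by fun_prop) (by fun_prop)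
  refine hclosed.closure_subset_iff.mpr (fun y hy => ?_) (hdense x)
  obtain ⟨m, hm⟩ := (hspan y hy).exists
  rw [Set.mem_ofPred_eq, ← hm]
  exact (B m).le_of_opNorm_le (hB_norm m) y

/-- The variation of a nondecreasing sequence in `[0, 1]` minus the indicator of `(n, ∞)`. -/
theorem variation_sub_indicator_le {u : ℕ → ℝ} (hu : Monotone u) (hu0 : ∀ k, 0 ≤ u k)
    (hu1 : ∀ k, u k ≤ 1) (n m : ℕ) :
    |u m - if n < m then 1 else 0| +
      ∑ k ∈ Finset.range m,
        |(u k - if n < k then 1 else 0) - (u (k + 1) - if n < k + 1 then 1 else 0)| ≤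
      2 * (u n + (1 - u (n + 1))) := by
  have hsum : ∀ m, ∑ k ∈ Finset.range m,
      |(u k - if n < k then 1 else 0) - (u (k + 1) - if n < k + 1 then 1 else 0)| =
      if n < m then 2 * u n - u 0 + 1 - 2 * u (n + 1) + u m else u m - u 0 := by
    intro m
    induction m with
    | zero => simp
    | succ m ih =>
      rw [Finset.sum_range_succ, ih]
      have hm := hu m.le_succ
      rcases lt_trichotomy n m with h | rfl | h
      · rw [if_pos h, if_pos h, if_pos (by omega), if_pos (by omega), abs_of_nonpos (by linarith)]
        ring
      · simp only [lt_irrefl, if_false, Nat.lt_succ_self, if_true]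
        rw [abs_of_nonneg (by linarith [hu0 n, hu1 (n + 1)])]
        ring
      · rw [if_neg (by omega), if_neg (by omega), if_neg (by omega), if_neg (by omega),
          abs_of_nonpos (by linarith)]
        ring
  rw [hsum]
  split_ifs with h
  · rw [abs_of_nonpos (by linarith [hu1 m])]
    linarith [hu0 0]
  · rw [sub_zero, abs_of_nonneg (hu0 m)]
    linarith [hu (not_lt.mp h), hu1 (n + 1), hu0 0]

/-- A positive sequence whose consecutive ratios tend to zero is `o(1 / n)`. -/
theorem tendsto_add_one_mul_of_ratio_tendsto_zero {a : ℕ → ℝ} (ha : ∀ k, 0 < a k)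
    (h : Tendsto (fun k => a (k + 1) / a k) atTop (𝓝 0)) :
    Tendsto (fun k : ℕ => ((k : ℝ) + 1) * a k) atTop (𝓝 0) := by
  refine Summable.tendsto_atTop_zero
    (summable_of_ratio_test_tendsto_lt_one (l := 0) one_pos ?_ ?_)
  · exact Eventually.of_forall fun k => (mul_pos (by positivity) (ha k)).ne'
  · have h2 : Tendsto (fun k => 2 * (a (k + 1) / a k)) atTop (𝓝 0) := by
      simpa using h.const_mul 2
    refine squeeze_zero (fun k => by positivity) (fun k => ?_) h2
    have := ha k
    have := ha (k + 1)
    rw [Real.norm_of_nonneg (by positivity), Real.norm_of_nonneg (by positivity), mul_div_mul_comm]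
    refine mul_le_mul_of_nonneg_right ?_ (by positivity)
    rw [div_le_iff₀ (by positivity)]
    push_cast
    linarith [(Nat.cast_nonneg k : (0 : ℝ) ≤ k)]

/-- If `1 - l k` decays superexponentially, suitable powers of `l n` tend to zero while the same
powers of `l (n + 1)` tend to one. -/
theorem exists_strictMono_pow_separating {l : ℕ → ℝ} (hmono : Monotone l) (hl0 : ∀ k, 0 ≤ l k)
    (hl1 : ∀ k, l k < 1)
    (hfast : Tendsto (fun k => (1 - l (k + 1)) / (1 - l k)) atTop (𝓝 0)) :
    ∃ N : ℕ → ℕ, StrictMono N ∧ (∀ n, 0 < N n) ∧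
      Tendsto (fun n => l n ^ N n + (1 - l (n + 1) ^ N n)) atTop (𝓝 0) := by
  have ha : ∀ k, 0 < 1 - l k := fun k => sub_pos.mpr (hl1 k)
  let s : ℕ → ℝ := fun n => √((1 - l n) * (1 - l (n + 1)))
  have hs : ∀ n, 0 < s n := fun n => Real.sqrt_pos.mpr (mul_pos (ha n) (ha (n + 1)))
  have hs_anti : Antitone s := by
    refine antitone_nat_of_succ_le fun n => Real.sqrt_le_sqrt ?_
    have h1 := hmono n.le_succ
    have h2 := hmono (n + 1).le_succ
    exact mul_le_mul (by linarith) (by linarith) (ha _).le (ha _).le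
  let N : ℕ → ℕ := fun n => ⌈(s n)⁻¹⌉₊ + (n + 1)
  refine ⟨N, ?_, fun n => by simp [N], ?_⟩
  · refine strictMono_nat_of_lt_succ fun n => ?_
    have : ⌈(s n)⁻¹⌉₊ ≤ ⌈(s (n + 1))⁻¹⌉₊ :=
      Nat.ceil_mono (inv_anti₀ (hs _) (hs_anti n.le_succ))
    simp only [N]
    omega
  · let r : ℕ → ℝ := fun n => √((1 - l (n + 1)) / (1 - l n))
    have hr : Tendsto r atTop (𝓝 0) := by simpa using hfast.sqrt
    have hr_pos : ∀ n, 0 < r n := fun n => Real.sqrt_pos.mpr (div_pos (ha _) (ha _))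
    have hr_succ : ∀ n, (1 - l (n + 1)) = r n * s n := fun n => by
      have h := (ha n).ne'
      have h1 : (1 - l (n + 1)) / (1 - l n) * ((1 - l n) * (1 - l (n + 1))) =
          (1 - l (n + 1)) ^ 2 := by
        field_simp
      rw [← Real.sqrt_mul (div_pos (ha _) (ha _)).le, h1, Real.sqrt_sq (ha (n + 1)).le]
    have hr_self : ∀ n, (1 - l n) * r n = s n := fun n => by
      have h := (ha n).ne'
      have h1 : s n = √((1 - l n) ^ 2 * ((1 - l (n + 1)) / (1 - l n))) := by
        simp only [s]
        congr 1
        field_simp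
      rw [h1, Real.sqrt_mul (sq_nonneg _), Real.sqrt_sq (ha n).le]
    have hlim : Tendsto (fun n => 2 * r n + (((n + 1 : ℕ) : ℝ) + 1) * (1 - l (n + 1)))
        atTop (𝓝 0) := by
      simpa using (hr.const_mul 2).add
        ((tendsto_add_one_mul_of_ratio_tendsto_zero ha hfast).comp (tendsto_add_atTop_nat 1))
    refine squeeze_zero (fun n => ?_) (fun n => ?_) hlim
    · exact add_nonneg (pow_nonneg (hl0 n) _)
        (sub_nonneg.mpr (pow_le_one₀ (hl0 _) (hl1 _).le))
    · have hN_ge : (s n)⁻¹ ≤ N n := (Nat.le_ceil _).trans (by simp only [N]; push_cast; linarith)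
      have hN_le : (N n : ℝ) ≤ (s n)⁻¹ + (((n + 1 : ℕ) : ℝ) + 1) := by
        have := (Nat.ceil_lt_add_one (inv_nonneg.mpr (hs n).le)).le
        simp only [N]
        push_cast
        linarith
      have hsmall : l n ^ N n ≤ r n := by
        have h1 : 1 + (N n : ℝ) * (1 - l n) ≤ (1 + (1 - l n)) ^ N n :=
          one_add_mul_le_pow (by linarith [ha n]) _
        have h2 : l n ^ N n * (1 + (1 - l n)) ^ N n ≤ 1 := by
          rw [← mul_pow]
          exact pow_le_one₀ (mul_nonneg (hl0 n) (by linarith [ha n]))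
            (by nlinarith [sq_nonneg (1 - l n)])
        have h3 : 1 ≤ r n * ((N n : ℝ) * (1 - l n)) := by
          have : (s n)⁻¹ * s n ≤ N n * s n := mul_le_mul_of_nonneg_right hN_ge (hs n).le
          rw [inv_mul_cancel₀ (hs n).ne', ← hr_self n] at this
          linarith
        have h4 : 0 ≤ l n ^ N n := pow_nonneg (hl0 n) _
        calc l n ^ N n ≤ l n ^ N n * (r n * ((N n : ℝ) * (1 - l n))) :=
              le_mul_of_one_le_right h4 h3
          _ = r n * (l n ^ N n * ((N n : ℝ) * (1 - l n))) := by ring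
          _ ≤ r n * 1 := mul_le_mul_of_nonneg_left
              ((mul_le_mul_of_nonneg_left (by linarith) h4).trans h2) (hr_pos n).le
          _ = r n := mul_one _
      have hlarge : 1 - l (n + 1) ^ N n ≤ r n + (((n + 1 : ℕ) : ℝ) + 1) * (1 - l (n + 1)) := by
        have h1 : 1 + (N n : ℝ) * (l (n + 1) - 1) ≤ (1 + (l (n + 1) - 1)) ^ N n :=
          one_add_mul_le_pow (by linarith [hl0 (n + 1)]) _
        rw [add_sub_cancel] at h1
        have h2 := mul_le_mul_of_nonneg_right hN_le (ha (n + 1)).le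
        have h3 : (s n)⁻¹ * (1 - l (n + 1)) = r n := by
          rw [hr_succ n, mul_comm, mul_assoc, mul_inv_cancel₀ (hs n).ne', mul_one]
        rw [add_mul, h3] at h2
        linarith
      linarith

open Filter Topology in
/-- For a fast monotone multiplier `T` there is an increasing sequence `(N_n)` of positive
integers with `‖T^{N_n} - Q_n‖ → 0`, where `Q_n = I - P_n`. -/
theorem fast_monotone_multiplier_power_approx {H : Type*} [NormedAddCommGroup H]
    [InnerProductSpace ℂ H] [CompleteSpace H]
    (e : ℕ → H) (hdense : Dense (Submodule.span ℂ (Set.range e) : Set H))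
    (P : ℕ → H →L[ℂ] H) (hproj : ∀ n, P n * P n = P n)
    (hP1 : ∀ n k, k ≤ n → P n (e k) = e k) (hP2 : ∀ n k, n < k → P n (e k) = 0)
    (b : ℝ) (hb : ∀ n, ‖P n‖ ≤ b)
    (l : ℕ → ℝ) (hmono : Monotone l) (hl0 : ∀ k, 0 ≤ l k) (hl1 : ∀ k, l k < 1)
    (hfast : Tendsto (fun k => (1 - l (k + 1)) / (1 - l k)) atTop (𝓝 0))
    (T : H →L[ℂ] H) (hT : ∀ k, T (e k) = (l k : ℂ) • e k) :
    ∃ N : ℕ → ℕ, StrictMono N ∧ (∀ n, 0 < N n) ∧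
      Tendsto (fun n => ‖T ^ N n - (1 - P n)‖) atTop (𝓝 0) := by
  obtain ⟨N, hN, hN0, hlim⟩ := exists_strictMono_pow_separating hmono hl0 hl1 hfast
  refine ⟨N, hN, hN0, ?_⟩
  have hpow : ∀ p k, (T ^ p) (e k) = ((l k ^ p : ℝ) : ℂ) • e k := by
    intro p k
    induction p with
    | zero => simp
    | succ p ih =>
      rw [pow_succ, mul_apply_eq_comp, hT, map_smul, ih, smul_smul]
      push_cast
      rw [pow_succ']
  have hbound : ∀ n, ‖T ^ N n - (1 - P n)‖ ≤ 2 * (l n ^ N n + (1 - l (n + 1) ^ N n)) * b := by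
    intro n
    refine norm_le_of_diagonal_of_variation_le hdense hP1 hP2 hb
      (f := fun k => l k ^ N n - if n < k then 1 else 0) (fun k => ?_)
      (variation_sub_indicator_le (u := fun k => l k ^ N n)
        (fun i j hij => pow_le_pow_left₀ (hl0 i) (hmono hij) _) (fun k => pow_nonneg (hl0 k) _)
        (fun k => pow_le_one₀ (hl0 k) (hl1 k).le) n)
    simp only [sub_apply, one_apply_eq_self, hpow]
    split_ifs with h
    · rw [hP2 n k h]
      push_cast
      module
    · rw [hP1 n k (not_lt.mp h)]
      push_cast
      module
  refine squeeze_zero (fun n => norm_nonneg _) hbound ?_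
  simpa using (hlim.const_mul 2).mul_const b
end
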